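/- arXiv:1307.7538 — 9 statements merged into one kernel-verified Lean document; each statement's English description precedes it below -/
import Mathlib

section
/- Let n ≥ 2 be an integer, let α_1, …, α_n be pairwise distinct complex numbers, and fix i ∈ {1, …, n}. Then ∑_{j≠i} (∏_{a=1}^{n−1} ((n−a)α_j + a·α_i)) / (∏_{k≠j} (α_j − α_k)) = −n^{n−1}·α_i^{n−1} / ∏_{j≠i}(α_i − α_j) + (n−1)!. -/
theorem prod_sub_aux (m : ℕ) :
    ∏ a ∈ Finset.Icc 1 m, (((m + 1 : ℕ) : ℂ) - (a : ℂ)) = (m.factorial : ℂ) := by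
  rw [← Finset.prod_range_add_one_eq_factorial, Nat.cast_prod]
  refine Finset.prod_nbij' (fun a => m - a) (fun a => m - a) ?_ ?_ ?_ ?_ ?_
  · intro a ha; simp only [Finset.mem_Icc, Finset.mem_range] at *; omega
  · intro a ha; simp only [Finset.mem_Icc, Finset.mem_range] at *; omega
  · intro a ha; simp only [Finset.mem_Icc, Finset.mem_range] at *; omega
  · intro a ha; simp only [Finset.mem_Icc, Finset.mem_range] at *; omega
  · intro a ha
    simp only [Finset.mem_Icc] at ha
    push_cast [Nat.cast_sub ha.2]
    ring


open Finset

/-- For `n ≥ 2` and pairwise distinct complex numbers `α_1, …, α_n` and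
fixed `i`, one has
`∑_{j≠i} (∏_{a=1}^{n−1} ((n−a)α_j + a·α_i)) / (∏_{k≠j} (α_j − α_k))
  = −n^{n−1}·α_i^{n−1} / ∏_{j≠i}(α_i − α_j) + (n−1)!`. -/
theorem stmt_0 (n : ℕ) (hn : 2 ≤ n) (α : Fin n → ℂ) (hα : Function.Injective α)
    (i : Fin n) :
    ∑ j ∈ univ.erase i,
        (∏ a ∈ Icc 1 (n - 1), (((n : ℂ) - (a : ℂ)) * α j + (a : ℂ) * α i)) /
          (∏ k ∈ univ.erase j, (α j - α k)) =
      -(n : ℂ) ^ (n - 1) * α i ^ (n - 1) / (∏ j ∈ univ.erase i, (α i - α j))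
        + ((n - 1).factorial : ℂ) := by
  obtain ⟨m, rfl⟩ : ∃ m, n = m + 1 := ⟨n - 1, by omega⟩
  simp only [Nat.add_sub_cancel]
  let f : ℕ → Polynomial ℂ := fun a =>
    Polynomial.C (((m + 1 : ℕ) : ℂ) - (a : ℂ)) * Polynomial.X + Polynomial.C ((a : ℂ) * α i)
  have hf : ∀ a ∈ Icc 1 m, (f a).natDegree ≤ 1 := fun a _ => Polynomial.natDegree_linear_le
  have hdeg : (∏ a ∈ Icc 1 m, f a).natDegree ≤ m := by
    refine (Polynomial.natDegree_prod_le _ _).trans ((Finset.sum_le_sum hf).trans ?_)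
    simp
  have hcoeff : (∏ a ∈ Icc 1 m, f a).coeff m = (m.factorial : ℂ) := by
    have h := Polynomial.coeff_prod_of_natDegree_le (Icc 1 m) f 1 hf
    simp only [Nat.card_Icc, Nat.add_sub_cancel, mul_one] at h
    rw [h, ← prod_sub_aux]
    refine Finset.prod_congr rfl fun a _ => ?_
    simp [f]
  have key := Lagrange.coeff_eq_sum (s := (univ : Finset (Fin (m + 1)))) (v := α)
    hα.injOn (P := ∏ a ∈ Icc 1 m, f a) (by
      refine lt_of_le_of_lt (Polynomial.degree_le_of_natDegree_le hdeg) ?_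
      rw [Finset.card_univ, Fintype.card_fin]
      exact_mod_cast Nat.lt_succ_self m)
  have heval : ∀ j, (∏ a ∈ Icc 1 m, f a).eval (α j) =
      ∏ a ∈ Icc 1 m, ((((m + 1 : ℕ) : ℂ) - (a : ℂ)) * α j + (a : ℂ) * α i) := by
    intro j
    rw [Polynomial.eval_prod]
    simp [f]
  simp only [heval, Finset.card_univ, Fintype.card_fin, Nat.add_sub_cancel, hcoeff] at key
  rw [← Finset.sum_erase_add _ _ (Finset.mem_univ i)] at key
  have hi : ∏ a ∈ Icc 1 m, ((((m + 1 : ℕ) : ℂ) - (a : ℂ)) * α i + (a : ℂ) * α i) =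
      ((m + 1 : ℕ) : ℂ) ^ m * α i ^ m := by
    rw [Finset.prod_congr rfl (g := fun _ => ((m + 1 : ℕ) : ℂ) * α i) (fun a _ => by ring)]
    simp [mul_pow]
  rw [hi] at key
  rw [key]
  ring
end

section
/- Let n ≥ 2 be an integer, let α_1, …, α_n be pairwise distinct complex numbers, and fix i ∈ {1, …, n}. Then ∑_{j≠i} (∏_{a=1}^{n−1} ((n−a)α_j + a·α_i)) / ((α_j − α_i)^2 · ∏_{k≠i,j} (α_j − α_k)) = (n^{n−1}·α_i^{n−1} / ∏_{j≠i}(α_i − α_j)) · ∑_{j≠i} 1/(α_i − α_j) − n^{n−1}(n−1)·α_i^{n−2} / (2·∏_{j≠i}(α_i − α_j)). -/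
open Finset

open Polynomial in
theorem residue_aux (n : ℕ) (hn : 2 ≤ n) (α : Fin n → ℂ) (hα : Function.Injective α)
    (i : Fin n) (P : ℂ[X]) (hP : P.natDegree ≤ n - 1) :
    ∑ j ∈ univ.erase i,
        P.eval (α j) / ((α j - α i) ^ 2 * ∏ k ∈ (univ.erase i).erase j, (α j - α k)) =
      (P.eval (α i) / (∏ j ∈ univ.erase i, (α i - α j))) *
          (∑ j ∈ univ.erase i, 1 / (α i - α j))
        - (derivative P).eval (α i) / (∏ j ∈ univ.erase i, (α i - α j)) := by
  set Q : ℂ[X] := Lagrange.nodal (univ.erase i) α with hQ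
  set q : ℂ := ∏ j ∈ univ.erase i, (α i - α j) with hq
  have hQq : Q.eval (α i) = q := by rw [hQ, Lagrange.eval_nodal]
  have hne : ∀ j ∈ univ.erase i, α i - α j ≠ 0 := fun j hj =>
    sub_ne_zero.mpr fun h => (Finset.ne_of_mem_erase hj) (hα h).symm
  have hq0 : q ≠ 0 := Finset.prod_ne_zero_iff.mpr hne
  have hQ' : (derivative Q).eval (α i) = q * ∑ j ∈ univ.erase i, 1 / (α i - α j) := by
    rw [hQ, Lagrange.derivative_nodal, eval_finsetSum, mul_sum]
    refine sum_congr rfl fun j hj => ?_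
    rw [Lagrange.eval_nodal, hq, ← Finset.mul_prod_erase _ _ hj]
    have := hne j hj
    field_simp
  have hQd : Q.natDegree = n - 1 := by
    rw [hQ, Lagrange.natDegree_nodal]; simp
  set T : ℂ[X] := P - C (P.eval (α i) / q) * Q with hT
  have hTd : T.natDegree ≤ n - 1 :=
    (natDegree_sub_le _ _).trans (max_le hP ((natDegree_C_mul_le _ _).trans hQd.le))
  have hTroot : IsRoot T (α i) := by
    simp [hT, IsRoot, hQq, hq0]
  set G : ℂ[X] := T /ₘ (X - C (α i)) with hG
  have hTG : (X - C (α i)) * G = T := mul_divByMonic_eq_iff_isRoot.mpr hTroot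
  have hGd : G.natDegree ≤ n - 2 := by
    rw [hG, natDegree_divByMonic _ (monic_X_sub_C _), natDegree_X_sub_C]; omega
  have hGi : G.eval (α i) = (derivative T).eval (α i) := by
    rw [← hTG]; simp
  have hGi2 : G.eval (α i) = (derivative P).eval (α i)
      - P.eval (α i) * ∑ j ∈ univ.erase i, 1 / (α i - α j) := by
    rw [hGi, hT]
    simp only [derivative_sub, derivative_C_mul, eval_sub, eval_mul, eval_C, hQ']
    field_simp
  have hGj : ∀ j ∈ univ.erase i, (α j - α i) * G.eval (α j) = P.eval (α j) := by
    intro j hj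
    have h := congrArg (eval (α j)) hTG
    rw [hT] at h
    have h0 : eval (α j) Q = 0 := Lagrange.eval_nodal_at_node hj
    simpa [h0] using h
  have key := Lagrange.coeff_eq_sum (s := (univ : Finset (Fin n))) (v := α) (P := G)
    hα.injOn (by
      refine lt_of_le_of_lt degree_le_natDegree ?_
      rw [card_univ, Fintype.card_fin]
      exact_mod_cast (by omega : G.natDegree < n))
  rw [card_univ, Fintype.card_fin, coeff_eq_zero_of_natDegree_lt (by omega),
    ← Finset.add_sum_erase _ _ (mem_univ i), ← hq, hGi2] at key
  have hs : ∑ j ∈ univ.erase i,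
        P.eval (α j) / ((α j - α i) ^ 2 * ∏ k ∈ (univ.erase i).erase j, (α j - α k)) =
      ∑ j ∈ univ.erase i, G.eval (α j) / ∏ k ∈ univ.erase j, (α j - α k) := by
    refine sum_congr rfl fun j hj => ?_
    have hij : i ∈ univ.erase j :=
      mem_erase.mpr ⟨(Finset.ne_of_mem_erase hj).symm, mem_univ i⟩
    rw [← Finset.mul_prod_erase (univ.erase j) _ hij, ← hGj j hj, Finset.erase_right_comm]
    have h1 : α j - α i ≠ 0 := by
      rw [← neg_sub]; exact neg_ne_zero.mpr (hne j hj)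
    rw [pow_two, mul_assoc, mul_div_mul_left _ _ h1]
  rw [hs]
  linear_combination -key

/-- For `n ≥ 2` and pairwise distinct complex numbers `α_1, …, α_n` and
fixed `i`, one has
`∑_{j≠i} (∏_{a=1}^{n−1} ((n−a)α_j + a·α_i)) / ((α_j − α_i)^2 · ∏_{k≠i,j} (α_j − α_k))
  = (n^{n−1}·α_i^{n−1} / ∏_{j≠i}(α_i − α_j)) · ∑_{j≠i} 1/(α_i − α_j)
    − n^{n−1}(n−1)·α_i^{n−2} / (2·∏_{j≠i}(α_i − α_j))`. -/
theorem stmt_1 (n : ℕ) (hn : 2 ≤ n) (α : Fin n → ℂ) (hα : Function.Injective α)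
    (i : Fin n) :
    ∑ j ∈ univ.erase i,
        (∏ a ∈ Icc 1 (n - 1), (((n : ℂ) - (a : ℂ)) * α j + (a : ℂ) * α i)) /
          ((α j - α i) ^ 2 * ∏ k ∈ (univ.erase i).erase j, (α j - α k)) =
      ((n : ℂ) ^ (n - 1) * α i ^ (n - 1) / (∏ j ∈ univ.erase i, (α i - α j))) *
          (∑ j ∈ univ.erase i, 1 / (α i - α j))
        - (n : ℂ) ^ (n - 1) * ((n : ℂ) - 1) * α i ^ (n - 2) /
            (2 * ∏ j ∈ univ.erase i, (α i - α j)) := by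
  classical
  let P : Polynomial ℂ := ∏ a ∈ Icc 1 (n - 1),
    (Polynomial.C ((n : ℂ) - (a : ℂ)) * Polynomial.X + Polynomial.C ((a : ℂ) * α i))
  have hPe : ∀ x, P.eval x = ∏ a ∈ Icc 1 (n - 1), (((n : ℂ) - (a : ℂ)) * x + (a : ℂ) * α i) := by
    intro x
    simp [P, Polynomial.eval_prod]
  have hPd : P.natDegree ≤ n - 1 := by
    refine (Polynomial.natDegree_prod_le _ _).trans ?_
    refine (Finset.sum_le_card_nsmul _ _ 1 fun a _ => Polynomial.natDegree_linear_le).trans ?_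
    simp
  have hval : ∀ a : ℕ, ((n : ℂ) - (a : ℂ)) * α i + (a : ℂ) * α i = n * α i := by
    intro a; ring
  have hPi : P.eval (α i) = (n : ℂ) ^ (n - 1) * α i ^ (n - 1) := by
    rw [hPe]; simp [hval, mul_pow]
  have hsum : ∀ m : ℕ, ∑ a ∈ Icc 1 m, ((n : ℂ) - (a : ℂ)) = m * n - m * (m + 1) / 2 := by
    intro m
    induction m with
    | zero => simp
    | succ k ih => rw [Finset.sum_Icc_succ_top (by omega), ih]; push_cast; ring
  have hPder : (Polynomial.derivative P).eval (α i) =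
      (n : ℂ) ^ (n - 1) * ((n : ℂ) - 1) * α i ^ (n - 2) / 2 := by
    have : (Polynomial.derivative P).eval (α i) =
        ∑ a ∈ Icc 1 (n - 1), ((n : ℂ) * α i) ^ (n - 2) * ((n : ℂ) - (a : ℂ)) := by
      simp only [P]
      rw [Polynomial.derivative_prod_finset, Polynomial.eval_finsetSum]
      refine sum_congr rfl fun a ha => ?_
      rw [Polynomial.eval_mul, Polynomial.eval_prod]
      have hc : ((Icc 1 (n - 1)).erase a).card = n - 2 := by
        rw [card_erase_of_mem ha]; simp; omega
      simp only [Polynomial.eval_add, Polynomial.eval_mul, Polynomial.eval_C, Polynomial.eval_X,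
        hval, prod_const, hc, Polynomial.derivative_add, Polynomial.derivative_C_mul,
        Polynomial.derivative_C, Polynomial.derivative_X]
      simp
    rw [this, ← mul_sum, hsum]
    obtain ⟨m, rfl⟩ : ∃ m, n = m + 2 := ⟨n - 2, by omega⟩
    simp only [Nat.add_sub_cancel, show m + 2 - 1 = m + 1 from rfl, mul_pow]
    push_cast
    ring
  have h := residue_aux n hn α hα i P hPd
  simp only [hPi, hPder] at h
  simp only [hPe] at h
  rw [h, div_div]
end

section
/- Let n ≥ 2 be an integer and let α_1, …, α_n be pairwise distinct nonzero complex numbers. Then ∑_{i=1}^{n} ∑_{j≠i} [ n·α_i · ∏_{a=1}^{n−1}((n−a)α_j + a·α_i) / ∏_{k≠j}(α_j − α_k) ] · ( ∑_{k≠i,j} 1/(α_i − α_k) − 1/(n·α_i) ) = (n! − n^{n−1})·(n−2)·(n+1)/2. -/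
open Finset

namespace Stmt2Aux

open Polynomial

/-- The homogeneous form `∏ ((N+1-a) y + a x)`. -/
noncomputable def P (N : ℕ) (x y : ℂ) : ℂ :=
  ∏ a ∈ Icc 1 N, ((((N + 1 : ℕ) : ℂ) - (a : ℂ)) * y + (a : ℂ) * x)

lemma P_diag (N : ℕ) (x : ℂ) : P N x x = ((N + 1 : ℕ) : ℂ) ^ N * x ^ N := by
  unfold P
  have : ∀ a ∈ Icc 1 N, ((((N + 1 : ℕ) : ℂ) - (a : ℂ)) * x + (a : ℂ) * x)
      = ((N + 1 : ℕ) : ℂ) * x := fun a _ => by ring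
  rw [prod_congr rfl this, prod_const, mul_pow]
  simp

lemma prod_fact (N : ℕ) : ∏ a ∈ Icc 1 N, (((N + 1 : ℕ) : ℂ) - (a : ℂ)) = (N.factorial : ℂ) := by
  have hf : ∀ M : ℕ, ∏ a ∈ Icc 1 M, a = M.factorial := by
    intro M
    induction M with
    | zero => simp
    | succ k ih => rw [prod_Icc_succ_top (by omega), ih, Nat.factorial_succ, mul_comm]
  rw [← hf, Nat.cast_prod]
  refine Finset.prod_nbij' (fun a => N + 1 - a) (fun a => N + 1 - a) ?_ ?_ ?_ ?_ ?_
  · intro a ha; simp only [mem_Icc] at *; omega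
  · intro a ha; simp only [mem_Icc] at *; omega
  · intro a ha; simp only [mem_Icc] at *; omega
  · intro a ha; simp only [mem_Icc] at *; omega
  · intro a ha
    simp only [mem_Icc] at ha
    rw [Nat.cast_sub (by omega)]

/-- Lagrange weights. -/
noncomputable def w {n : ℕ} (α : Fin n → ℂ) (j : Fin n) : ℂ :=
  (∏ k ∈ univ.erase j, (α j - α k))⁻¹

lemma lagr {N : ℕ} (α : Fin (N + 1) → ℂ) (hα : Function.Injective α) (p : ℂ[X])
    (hp : p.natDegree ≤ N) : ∑ j, w α j * p.eval (α j) = p.coeff N := by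
  have h := Lagrange.coeff_eq_sum (s := (univ : Finset (Fin (N + 1)))) (v := α)
    (hα.injOn) (P := p) (by
      refine lt_of_le_of_lt degree_le_natDegree ?_
      rw [card_univ, Fintype.card_fin]
      exact_mod_cast Nat.lt_succ_of_le hp)
  rw [card_univ, Fintype.card_fin, Nat.add_sub_cancel] at h
  rw [h]
  refine sum_congr rfl fun j _ => ?_
  rw [w, div_eq_mul_inv, mul_comm]

lemma lagr_pow {N : ℕ} (α : Fin (N + 1) → ℂ) (hα : Function.Injective α) (r : ℕ)
    (hr : r ≤ N) : ∑ j, w α j * α j ^ r = if N = r then 1 else 0 := by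
  have h := lagr α hα (X ^ r) (by simpa using hr)
  simpa [coeff_X_pow] using h

lemma natDegree_prod_lin (N : ℕ) (b c : ℕ → ℂ) :
    (∏ a ∈ Icc 1 N, (C (b a) * X + C (c a))).natDegree ≤ N := by
  refine (natDegree_prod_le _ _).trans ?_
  refine (sum_le_sum (g := fun _ => 1) fun a _ => natDegree_linear_le).trans ?_
  simp

lemma factA {N : ℕ} (α : Fin (N + 1) → ℂ) (hα : Function.Injective α) (x : ℂ) :
    ∑ j, w α j * P N x (α j) = (N.factorial : ℂ) := by
  have h := lagr α hα _ (natDegree_prod_lin N (fun a => ((N + 1 : ℕ) : ℂ) - (a : ℂ))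
    (fun a => (a : ℂ) * x))
  have h2 := coeff_prod_of_natDegree_le (s := Icc 1 N)
    (fun a : ℕ => (C (((N + 1 : ℕ) : ℂ) - (a : ℂ)) * X + C ((a : ℂ) * x))) 1
    (fun a _ => natDegree_linear_le)
  rw [Nat.card_Icc, Nat.add_sub_cancel, mul_one] at h2
  rw [h2] at h
  simp only [coeff_add, coeff_C_mul, coeff_X_one, mul_one, coeff_C_succ, add_zero] at h
  rw [prod_fact] at h
  rw [← h]
  refine sum_congr rfl fun j _ => ?_
  simp [P, eval_prod]

lemma sum_Icc_id (N : ℕ) : ∑ a ∈ Icc 1 N, (a : ℂ) = N * (N + 1) / 2 := by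
  induction N with
  | zero => simp
  | succ k ih =>
    rw [sum_Icc_succ_top (by omega), ih]; push_cast; ring

/-- univariate dehomogenisation -/
noncomputable def p (N : ℕ) : ℂ[X] :=
  ∏ a ∈ Icc 1 N, (C (a : ℂ) * X + C (((N + 1 : ℕ) : ℂ) - (a : ℂ)))

lemma p_deg (N : ℕ) : (p N).natDegree ≤ N :=
  natDegree_prod_lin N (fun a => (a : ℂ)) (fun a => ((N + 1 : ℕ) : ℂ) - (a : ℂ))

lemma p_one (N : ℕ) : (p N).eval 1 = ((N + 1 : ℕ) : ℂ) ^ N := by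
  simp [p, eval_prod]

lemma p_hom (N : ℕ) (x y : ℂ) (hx : x ≠ 0) : P N y x = x ^ N * (p N).eval (y / x) := by
  have : x ^ N = ∏ a ∈ Icc 1 N, x := by simp
  rw [this, p, eval_prod, ← prod_mul_distrib, P]
  refine prod_congr rfl fun a _ => ?_
  simp only [eval_add, eval_mul, eval_C, eval_X]
  field_simp
  ring

lemma p_der (N : ℕ) : (derivative (p N)).eval 1 = ((N + 1 : ℕ) : ℂ) ^ N * N / 2 := by
  rw [p, derivative_prod_finset, eval_finsetSum]
  have : ∀ a ∈ Icc 1 N, eval 1 ((∏ b ∈ (Icc 1 N).erase a,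
      (C (b : ℂ) * X + C (((N + 1 : ℕ) : ℂ) - (b : ℂ)))) *
      derivative (C (a : ℂ) * X + C (((N + 1 : ℕ) : ℂ) - (a : ℂ))))
      = ((N + 1 : ℕ) : ℂ) ^ (N - 1) * (a : ℂ) := by
    intro a ha
    simp only [derivative_add, derivative_C_mul, derivative_X, derivative_C, eval_mul,
      eval_prod, eval_add, eval_C, eval_X, mul_one, add_zero, add_sub_cancel, prod_const,
      card_erase_of_mem ha, Nat.card_Icc, Nat.add_sub_cancel]
  rw [sum_congr rfl this, ← mul_sum, sum_Icc_id]
  cases N with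
  | zero => simp
  | succ k => rw [Nat.add_sub_cancel, pow_succ]; push_cast; ring

lemma exists_f (N : ℕ) : ∃ f : ℂ[X], f.natDegree ≤ N ∧
    X * p N - C (((N + 1 : ℕ) : ℂ) ^ N) = (X - C 1) * f := by
  have hr : IsRoot (X * p N - C (((N + 1 : ℕ) : ℂ) ^ N)) 1 := by
    simp only [IsRoot, eval_sub, eval_mul, eval_X, eval_C, p_one]; ring
  refine ⟨(X * p N - C (((N + 1 : ℕ) : ℂ) ^ N)) /ₘ (X - C 1), ?_,
    (mul_divByMonic_eq_iff_isRoot.2 hr).symm⟩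
  rw [natDegree_divByMonic _ (monic_X_sub_C 1), natDegree_X_sub_C]
  have h1 : (X * p N - C (((N + 1 : ℕ) : ℂ) ^ N)).natDegree ≤ N + 1 := by
    rw [natDegree_sub_C]
    refine natDegree_mul_le.trans ?_
    have := p_deg N
    rw [natDegree_X]; omega
  omega

lemma factC {N : ℕ} (α : Fin (N + 1) → ℂ) (hα : Function.Injective α) (hα0 : ∀ i, α i ≠ 0) :
    ∃ F : ℂ → ℂ → ℂ,
      (∀ x y, x ≠ 0 → F x y * (x - y) = ((N + 1 : ℕ) : ℂ) ^ N * x ^ (N + 1) - y * P N y x) ∧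
      (∀ x, x ≠ 0 → F x x = ((N + 1 : ℕ) : ℂ) ^ N * (N + 2) / 2 * x ^ N) ∧
      (∀ y, ∑ i, w α i * F (α i) y = ((N + 1 : ℕ) : ℂ) ^ N) := by
  obtain ⟨f, hf, hfe⟩ := exists_f N
  have hev : ∀ t, t * (p N).eval t - ((N + 1 : ℕ) : ℂ) ^ N = (t - 1) * f.eval t := by
    intro t
    simpa only [eval_sub, eval_mul, eval_X, eval_C] using congrArg (eval t) hfe
  have hf1 : f.eval 1 = ((N + 1 : ℕ) : ℂ) ^ N * (N + 2) / 2 := by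
    have h := congrArg (fun q => eval 1 (derivative q)) hfe
    simp only [derivative_sub, derivative_mul, derivative_X, derivative_C, eval_sub, eval_add,
      eval_mul, eval_X, eval_C, p_der, p_one, eval_one, eval_zero] at h
    linear_combination -h
  have hf0 : f.coeff 0 = ((N + 1 : ℕ) : ℂ) ^ N := by
    rw [coeff_zero_eq_eval_zero]
    linear_combination hev 0
  refine ⟨fun x y => x ^ N * f.eval (y / x), ?_, ?_, ?_⟩
  · intro x y hx
    show x ^ N * f.eval (y / x) * (x - y) = _
    have h := hev (y / x)
    rw [p_hom N x y hx]
    have e1 : y = x * (y / x) := by field_simp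
    generalize y / x = t at *
    subst e1
    linear_combination (x ^ (N + 1)) * h
  · intro x hx
    simp only [div_self hx, hf1]; ring
  · intro y
    have h1 : ∀ i, w α i * (α i ^ N * f.eval (y / α i)) =
        ∑ m ∈ range (N + 1), f.coeff m * y ^ m * (w α i * α i ^ (N - m)) := by
      intro i
      rw [eval_eq_sum_range' (Nat.lt_succ_of_le hf), mul_sum, mul_sum]
      refine sum_congr rfl fun m hm => ?_
      have hm' : m ≤ N := Nat.lt_succ_iff.1 (mem_range.1 hm)
      have h2 : α i ^ N = α i ^ (N - m) * α i ^ m := by rw [← pow_add, Nat.sub_add_cancel hm']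
      have := hα0 i
      rw [h2, div_pow]
      field_simp
    simp only [h1]
    rw [sum_comm]
    simp only [← mul_sum]
    rw [sum_eq_single 0]
    · rw [lagr_pow α hα _ (by omega)]; simp [hf0]
    · intro m hm hm0
      have := mem_range.1 hm
      rw [lagr_pow α hα _ (by omega), if_neg (by omega), mul_zero]
    · simp

lemma sum_pairs {N : ℕ} (α : Fin (N + 1) → ℂ) (hα : Function.Injective α) :
    ∑ i, ∑ k, α i * (1 / (α i - α k)) = ((N : ℂ) + 1) * N / 2 := by
  have h1 : ∑ i, ∑ k, α i * (1 / (α i - α k)) = ∑ i, ∑ k, α k * (1 / (α k - α i)) := sum_comm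
  have h2 : ∑ i, ∑ k, α i * (1 / (α i - α k)) + ∑ i, ∑ k, α k * (1 / (α k - α i))
      = ((N : ℂ) + 1) * N := by
    simp only [← sum_add_distrib]
    have : ∀ i k, α i * (1 / (α i - α k)) + α k * (1 / (α k - α i)) = if k = i then 0 else 1 := by
      intro i k
      split_ifs with h
      · subst h; simp
      · have e1 : α i - α k ≠ 0 := sub_ne_zero.2 fun e => h (hα e).symm
        have e2 : α k - α i = -(α i - α k) := by ring
        rw [e2]
        field_simp
        ring
    simp only [this]
    have h3 : ∀ i : Fin (N + 1), ∑ k, (if k = i then (0 : ℂ) else 1) = N := by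
      intro i
      have : ∀ k, (if k = i then (0 : ℂ) else 1) = 1 - if k = i then 1 else 0 := by
        intro k; split_ifs <;> simp
      simp [this]
    simp [h3]
  rw [← h1] at h2
  linear_combination h2 / 2

lemma row {N : ℕ} (α : Fin (N + 1) → ℂ) (hα : Function.Injective α) (hα0 : ∀ i, α i ≠ 0)
    (i : Fin (N + 1)) :
    ∑ j ∈ univ.erase i,
        (((N + 1 : ℕ) : ℂ) * α i * P N (α i) (α j) / (∏ k ∈ univ.erase j, (α j - α k))) *
          ((∑ k ∈ (univ.erase i).erase j, 1 / (α i - α k)) - 1 / (((N + 1 : ℕ) : ℂ) * α i)) =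
      (((N + 1 : ℕ) : ℂ) * (∑ k, α i * (1 / (α i - α k))) - 1) *
        (N.factorial - ((N + 1 : ℕ) : ℂ) ^ N * (w α i * α i ^ N))
      - ((N + 1 : ℕ) : ℂ) * ∑ j, α i * P N (α i) (α j) * w α j * (1 / (α i - α j)) := by
  have hn : ((N + 1 : ℕ) : ℂ) ≠ 0 := by exact_mod_cast N.succ_ne_zero
  have hi := hα0 i
  set E := ∑ k, 1 / (α i - α k) with hE
  have hsub : ∀ j ∈ univ.erase i,
      (((N + 1 : ℕ) : ℂ) * α i * P N (α i) (α j) / (∏ k ∈ univ.erase j, (α j - α k))) *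
          ((∑ k ∈ (univ.erase i).erase j, 1 / (α i - α k)) - 1 / (((N + 1 : ℕ) : ℂ) * α i)) =
      (((N + 1 : ℕ) : ℂ) * (α i * E) - 1) * (w α j * P N (α i) (α j))
       - ((N + 1 : ℕ) : ℂ) * (α i * P N (α i) (α j) * w α j * (1 / (α i - α j))) := by
    intro j hj
    have e1 := add_sum_erase (univ.erase i) (fun k => 1 / (α i - α k)) hj
    have e2 := add_sum_erase univ (fun k => 1 / (α i - α k)) (mem_univ i)
    simp only [sub_self, div_zero, zero_add] at e2
    rw [e2, ← hE] at e1
    have e3 : ∑ k ∈ (univ.erase i).erase j, 1 / (α i - α k) = E - 1 / (α i - α j) := by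
      linear_combination e1
    rw [e3, div_eq_mul_inv _ (∏ k ∈ univ.erase j, (α j - α k)), ← w]
    have e4 : ((N + 1 : ℕ) : ℂ) * α i * (1 / (((N + 1 : ℕ) : ℂ) * α i)) = 1 := by field_simp
    linear_combination (-(P N (α i) (α j) * w α j)) * e4
  rw [sum_congr rfl hsub, sum_sub_distrib, ← mul_sum, ← mul_sum, ← mul_sum]
  have a1 := add_sum_erase univ (fun j => w α j * P N (α i) (α j)) (mem_univ i)
  have a2 := add_sum_erase univ
    (fun j => α i * P N (α i) (α j) * w α j * (1 / (α i - α j))) (mem_univ i)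
  simp only [sub_self, div_zero, mul_zero, zero_add] at a2
  rw [a2]
  rw [factA α hα, P_diag] at a1
  rw [← hE]
  linear_combination (((N + 1 : ℕ) : ℂ) * (α i * E) - 1) * a1

lemma main {N : ℕ} (α : Fin (N + 1) → ℂ) (hα : Function.Injective α) (hα0 : ∀ i, α i ≠ 0) :
    ∑ i, ∑ j ∈ univ.erase i,
        (((N + 1 : ℕ) : ℂ) * α i * P N (α i) (α j) / (∏ k ∈ univ.erase j, (α j - α k))) *
          ((∑ k ∈ (univ.erase i).erase j, 1 / (α i - α k)) - 1 / (((N + 1 : ℕ) : ℂ) * α i)) =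
      (((N + 1) * N.factorial : ℂ) - ((N + 1 : ℕ) : ℂ) ^ N) * ((N : ℂ) - 1) * ((N : ℂ) + 2) / 2 := by
  rw [sum_congr rfl fun i _ => row α hα hα0 i]
  obtain ⟨F, hF1, hF2, hF3⟩ := factC α hα hα0
  have hB : ∑ j, w α j * α j ^ N = 1 := by simpa using lagr_pow α hα N le_rfl
  have hS := sum_pairs α hα
  set n : ℂ := ((N + 1 : ℕ) : ℂ) with hn
  have hnN : n = N + 1 := by rw [hn]; push_cast; ring
  -- the combined double sum
  have hK : ∑ i, ((∑ k, α i * (1 / (α i - α k))) * (n ^ N * (w α i * α i ^ N)))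
      + ∑ i, ∑ j, α i * P N (α i) (α j) * w α j * (1 / (α i - α j)) = n ^ N * N / 2 := by
    rw [sum_comm (f := fun i j => α i * P N (α i) (α j) * w α j * (1 / (α i - α j)))]
    have h1 : ∀ i, (∑ k, α i * (1 / (α i - α k))) * (n ^ N * (w α i * α i ^ N))
        + ∑ j, α j * P N (α j) (α i) * w α i * (1 / (α j - α i))
        = ∑ j, w α i * F (α i) (α j) - n ^ N * (N + 2) / 2 * (w α i * α i ^ N) := by
      intro i
      rw [sum_mul, ← sum_add_distrib]
      have h2 : ∀ j, α i * (1 / (α i - α j)) * (n ^ N * (w α i * α i ^ N))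
          + α j * P N (α j) (α i) * w α i * (1 / (α j - α i))
          = w α i * F (α i) (α j) -
            if j = i then n ^ N * (N + 2) / 2 * (w α i * α i ^ N) else 0 := by
        intro j
        split_ifs with h
        · subst h
          rw [hF2 _ (hα0 j)]; simp; ring
        · have e1 : α i - α j ≠ 0 := sub_ne_zero.2 fun e => h (hα e).symm
          have e2 : α j - α i = -(α i - α j) := by ring
          have e3 := hF1 (α i) (α j) (hα0 i)
          have e4 : F (α i) (α j) = (n ^ N * α i ^ (N + 1) - α j * P N (α j) (α i))
              / (α i - α j) := by rw [eq_div_iff e1, e3]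
          rw [e2, e4]
          field_simp
          ring
      simp only [h2, sum_sub_distrib, sum_ite_eq', mem_univ, if_true]
    rw [← sum_add_distrib]
    simp only [h1, sum_sub_distrib]
    rw [sum_comm, ← mul_sum, hB]
    simp only [hF3]
    simp only [sum_const, card_univ, Fintype.card_fin, nsmul_eq_mul, ← hn]
    rw [hnN]; ring
  have hR : ∀ i, (n * (∑ k, α i * (1 / (α i - α k))) - 1) *
        (N.factorial - n ^ N * (w α i * α i ^ N))
      - n * ∑ j, α i * P N (α i) (α j) * w α j * (1 / (α i - α j))
      = n * N.factorial * (∑ k, α i * (1 / (α i - α k))) - N.factorial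
        + n ^ N * (w α i * α i ^ N)
        - n * ((∑ k, α i * (1 / (α i - α k))) * (n ^ N * (w α i * α i ^ N)))
        - n * ∑ j, α i * P N (α i) (α j) * w α j * (1 / (α i - α j)) := by
    intro i; ring
  rw [sum_congr rfl fun i _ => hR i]
  rw [sum_sub_distrib, sum_sub_distrib, sum_add_distrib, sum_sub_distrib, ← mul_sum, ← mul_sum,
    ← mul_sum, ← mul_sum, hS, hB]
  simp only [sum_const, card_univ, Fintype.card_fin, nsmul_eq_mul, ← hn]
  generalize n ^ N = M at *
  rw [hnN] at *
  linear_combination (-((N : ℂ) + 1)) * hK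

end Stmt2Aux

/-- For `n ≥ 2` and pairwise distinct nonzero complex numbers
`α_1, …, α_n`,
`∑_{i=1}^{n} ∑_{j≠i} [n·α_i · ∏_{a=1}^{n−1}((n−a)α_j + a·α_i) / ∏_{k≠j}(α_j − α_k)]
    · (∑_{k≠i,j} 1/(α_i − α_k) − 1/(n·α_i))
  = (n! − n^{n−1})·(n−2)·(n+1)/2`. -/
theorem stmt_2 (n : ℕ) (hn : 2 ≤ n) (α : Fin n → ℂ) (hα : Function.Injective α)
    (hα0 : ∀ i, α i ≠ 0) :
    ∑ i : Fin n, ∑ j ∈ univ.erase i,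
        ((n : ℂ) * α i *
            (∏ a ∈ Icc 1 (n - 1), (((n : ℂ) - (a : ℂ)) * α j + (a : ℂ) * α i)) /
            (∏ k ∈ univ.erase j, (α j - α k))) *
          ((∑ k ∈ (univ.erase i).erase j, 1 / (α i - α k)) - 1 / ((n : ℂ) * α i)) =
      ((n.factorial : ℂ) - (n : ℂ) ^ (n - 1)) * ((n : ℂ) - 2) * ((n : ℂ) + 1) / 2 := by
  obtain ⟨N, rfl⟩ : ∃ N, n = N + 1 := ⟨n - 1, by omega⟩
  refine (Stmt2Aux.main α hα hα0).trans ?_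
  rw [Nat.factorial_succ, Nat.add_sub_cancel]
  push_cast
  ring
end

section
/- Let m ≥ 2 be an integer and c_1, …, c_m positive integers; set n = m − 1 + ∑_{l=1}^m c_l (so that ∑_{l=1}^m c_l = n − m + 1) and N = n − m + 1. Let α_1, …, α_N be pairwise distinct complex numbers and fix i ∈ {1, …, N}. Then ∑_{j≠i} (∏_{l=1}^{m} ∏_{a=1}^{c_l−1} ((c_l − a)α_j + a·α_i)) / (∏_{k≠j}(α_j − α_k)) = −(∏_{l=1}^{m} c_l^{c_l−1}) · α_i^{n−2m+1} / ∏_{j≠i}(α_i − α_j). -/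
open Finset

/-- Let `m ≥ 2`, `c_1, …, c_m` positive integers, `n = m − 1 + ∑ c_l`,
`N = n − m + 1`. For pairwise distinct complex numbers `α_1, …, α_N` and fixed `i`,
`∑_{j≠i} (∏_{l=1}^{m} ∏_{a=1}^{c_l−1} ((c_l − a)α_j + a·α_i)) / (∏_{k≠j}(α_j − α_k))
  = −(∏_{l} c_l^{c_l−1}) · α_i^{n−2m+1} / ∏_{j≠i}(α_i − α_j)`.
(The natural-number exponent `n − 2m + 1` is written `n + 1 - 2*m`, which agrees with it
since `n ≥ 2m − 1`.) -/
theorem stmt_3 (m : ℕ) (hm : 2 ≤ m) (c : Fin m → ℕ) (hc : ∀ l, 0 < c l)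
    (n N : ℕ) (hn : n = m - 1 + ∑ l, c l) (hN : N = n - m + 1)
    (α : Fin N → ℂ) (hα : Function.Injective α) (i : Fin N) :
    ∑ j ∈ univ.erase i,
        (∏ l, ∏ a ∈ Icc 1 (c l - 1), (((c l : ℂ) - (a : ℂ)) * α j + (a : ℂ) * α i)) /
          (∏ k ∈ univ.erase j, (α j - α k)) =
      -(∏ l, (c l : ℂ) ^ (c l - 1)) * α i ^ (n + 1 - 2 * m) /
        (∏ j ∈ univ.erase i, (α i - α j)) := by
  have hS : ∑ l, (c l - 1) + m = ∑ l, c l := by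
    have h : ∑ l, (c l - 1 + 1) = ∑ l, c l :=
      Finset.sum_congr rfl fun l _ => Nat.sub_add_cancel (hc l)
    rw [Finset.sum_add_distrib] at h
    simpa using h
  have hNS : N = ∑ l, c l := by omega
  have hexp : n + 1 - 2 * m = ∑ l, (c l - 1) := by omega
  let P : Polynomial ℂ := ∏ l, ∏ a ∈ Icc 1 (c l - 1),
    (Polynomial.C ((c l : ℂ) - (a : ℂ)) * Polynomial.X + Polynomial.C ((a : ℂ) * α i))
  have hev : ∀ x, P.eval x =
      ∏ l, ∏ a ∈ Icc 1 (c l - 1), (((c l : ℂ) - (a : ℂ)) * x + (a : ℂ) * α i) := by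
    intro x
    simp [P, Polynomial.eval_prod]
  have hdeg : P.natDegree ≤ ∑ l, (c l - 1) := by
    refine (Polynomial.natDegree_prod_le _ _).trans (Finset.sum_le_sum fun l _ => ?_)
    refine (Polynomial.natDegree_prod_le _ _).trans ?_
    refine (Finset.sum_le_card_nsmul _ _ 1 fun a _ => ?_).trans (by simp)
    exact Polynomial.natDegree_linear_le
  have hlt : P.natDegree < N - 1 := by omega
  have hP : P.degree < #(univ : Finset (Fin N)) := by
    refine lt_of_le_of_lt Polynomial.degree_le_natDegree ?_
    rw [Finset.card_univ, Fintype.card_fin]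
    exact_mod_cast (by omega : P.natDegree < N)
  have key := Lagrange.coeff_eq_sum (s := (univ : Finset (Fin N))) (v := α) hα.injOn hP
  rw [Finset.card_univ, Fintype.card_fin, Polynomial.coeff_eq_zero_of_natDegree_lt hlt,
    ← Finset.add_sum_erase _ _ (mem_univ i)] at key
  have hPi : P.eval (α i) = (∏ l, (c l : ℂ) ^ (c l - 1)) * α i ^ (n + 1 - 2 * m) := by
    rw [hev, hexp, ← Finset.prod_pow_eq_pow_sum, ← Finset.prod_mul_distrib]
    refine Finset.prod_congr rfl fun l _ => ?_
    rw [← mul_pow]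
    have : ∀ a ∈ Icc 1 (c l - 1),
        ((c l : ℂ) - (a : ℂ)) * α i + (a : ℂ) * α i = (c l : ℂ) * α i := by
      intro a _
      ring
    rw [Finset.prod_congr rfl this]
    simp
  simp only [← hev]
  rw [neg_mul, neg_div, ← hPi]
  exact eq_neg_of_add_eq_zero_right key.symm
end

section
/- Let m ≥ 2 be an integer and c_1, …, c_m positive integers; set n = m − 1 + ∑_{l=1}^m c_l (so that ∑_{l=1}^m c_l = n − m + 1) and N = n − m + 1. Let α_1, …, α_N be pairwise distinct nonzero complex numbers and fix i ∈ {1, …, N}. Then ∑_{j≠i} (∏_{l=1}^{m} ∏_{a=1}^{c_l−1} ((c_l − a)α_j + a·α_i)) / ((α_j − α_i)^2 · ∏_{k≠i,j}(α_j − α_k)) = (∏_{l=1}^{m} c_l^{c_l−1}) · α_i^{n−2m+1} / ∏_{j≠i}(α_i − α_j) · ∑_{j≠i} 1/(α_i − α_j) − (n − 2m + 1)·(∏_{l=1}^{m} c_l^{c_l−1}) · α_i^{n−2m} / (2·∏_{j≠i}(α_i − α_j)). -/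
open Finset

open Polynomial in
lemma aux_logder {ι : Type*} [DecidableEq ι] (s : Finset ι) (f : ι → ℂ[X]) (x : ℂ)
    (h : ∀ i ∈ s, (f i).eval x ≠ 0) :
    (derivative (∏ i ∈ s, f i)).eval x =
      (∏ i ∈ s, (f i).eval x) * ∑ i ∈ s, (derivative (f i)).eval x / (f i).eval x := by
  induction s using Finset.induction_on with
  | empty => simp
  | insert a s ha ih =>
    have h1 := h a (Finset.mem_insert_self a s)
    have h2 := ih (fun i hi => h i (Finset.mem_insert_of_mem hi))
    rw [Finset.prod_insert ha, Finset.prod_insert ha, Finset.sum_insert ha, derivative_mul,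
      eval_add, eval_mul, eval_mul, h2, eval_prod]
    field_simp

open Polynomial in
lemma aux_residue {ι : Type*} [DecidableEq ι] (S : Finset ι) (v : ι → ℂ)
    (hv : Function.Injective v) (P : ℂ[X]) (hP : P.degree < (S.card : WithBot ℕ)) (x : ℂ)
    (hx : ∀ j ∈ S, x - v j ≠ 0) :
    ∑ j ∈ S, P.eval (v j) / ((v j - x) ^ 2 * ∏ k ∈ S.erase j, (v j - v k)) =
      P.eval x / (∏ j ∈ S, (x - v j)) * (∑ j ∈ S, 1 / (x - v j))
        - (derivative P).eval x / (∏ j ∈ S, (x - v j)) := by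
  have hQ : (∏ j ∈ S, (x - v j)) ≠ 0 := Finset.prod_ne_zero_iff.mpr hx
  have hdec : P = ∑ j ∈ S, C (P.eval (v j) / ∏ k ∈ S.erase j, (v j - v k)) *
      ∏ k ∈ S.erase j, (X - C (v k)) := by
    conv_lhs => rw [Lagrange.eq_interpolate (s := S) (v := v) hv.injOn hP]
    rw [Lagrange.interpolate_apply]
    refine Finset.sum_congr rfl fun j _ => ?_
    simp only [Lagrange.basis, Lagrange.basisDivisor]
    rw [Finset.prod_mul_distrib, ← map_prod, ← mul_assoc, ← map_mul, Finset.prod_inv_distrib,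
      div_eq_mul_inv]
  have hE : ∀ j ∈ S, ∏ k ∈ S.erase j, (x - v k) = (∏ k ∈ S, (x - v k)) / (x - v j) := by
    intro j hj
    rw [← Finset.mul_prod_erase S _ hj]
    field_simp [hx j hj]
  have hE2 : ∀ j ∈ S, ∑ k ∈ S.erase j, 1 / (x - v k) =
      (∑ k ∈ S, 1 / (x - v k)) - 1 / (x - v j) := by
    intro j hj
    rw [← Finset.add_sum_erase S _ hj]
    ring
  have h0 : P.eval x = ∑ j ∈ S, (P.eval (v j) / ∏ k ∈ S.erase j, (v j - v k)) *
      ((∏ k ∈ S, (x - v k)) / (x - v j)) := by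
    conv_lhs => rw [hdec]
    rw [eval_finset_sum]
    refine Finset.sum_congr rfl fun j hj => ?_
    rw [← hE j hj]
    simp [eval_prod]
  have h1 : (derivative P).eval x = ∑ j ∈ S, (P.eval (v j) / ∏ k ∈ S.erase j, (v j - v k)) *
      ((∏ k ∈ S, (x - v k)) / (x - v j) * ((∑ k ∈ S, 1 / (x - v k)) - 1 / (x - v j))) := by
    conv_lhs => rw [hdec]
    rw [derivative_sum, eval_finset_sum]
    refine Finset.sum_congr rfl fun j hj => ?_
    rw [← hE j hj, ← hE2 j hj, derivative_C_mul, eval_C_mul, aux_logder]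
    · simp
    · intro k hk
      simpa using hx k (Finset.mem_of_mem_erase hk)
  rw [h0, h1, Finset.sum_div, Finset.sum_mul, Finset.sum_div, ← Finset.sum_sub_distrib]
  refine Finset.sum_congr rfl fun j hj => ?_
  have hxj := hx j hj
  have hP' : ∏ k ∈ S.erase j, (v j - v k) ≠ 0 := by
    refine Finset.prod_ne_zero_iff.mpr fun k hk => sub_ne_zero.mpr fun h => ?_
    exact (Finset.ne_of_mem_erase hk) (hv h).symm
  generalize (∑ k ∈ S, 1 / (x - v k)) = T
  rw [show (v j - x) ^ 2 = (x - v j) ^ 2 by ring]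
  field_simp
  ring

lemma aux_sum (c : ℕ) (hc : 0 < c) (x : ℂ) (hx : x ≠ 0) :
    ∑ a ∈ Finset.Icc 1 (c - 1), ((c : ℂ) - a) / ((c : ℂ) * x) = ((c : ℂ) - 1) / (2 * x) := by
  have hc' : (c : ℂ) ≠ 0 := by exact_mod_cast hc.ne'
  rw [← Finset.sum_div, Finset.sum_sub_distrib]
  have h : ∀ d : ℕ, ∑ a ∈ Finset.Icc 1 d, (a : ℂ) = d * (d + 1) / 2 := by
    intro d
    induction d with
    | zero => simp
    | succ d ih => rw [Finset.sum_Icc_succ_top (by omega), ih]; push_cast; ring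
  rw [h]
  obtain ⟨d, rfl⟩ : ∃ d, c = d + 1 := ⟨c - 1, by omega⟩
  simp only [Finset.sum_const, Nat.card_Icc, Nat.add_sub_cancel, nsmul_eq_mul]
  push_cast at hc' ⊢
  field_simp
  ring

/-- Let `m ≥ 2`, `c_1, …, c_m` positive integers, `n = m − 1 + ∑ c_l`,
`N = n − m + 1`. For pairwise distinct nonzero complex numbers `α_1, …, α_N` and fixed `i`,
`∑_{j≠i} (∏_{l} ∏_{a=1}^{c_l−1} ((c_l − a)α_j + a·α_i)) / ((α_j − α_i)^2 · ∏_{k≠i,j}(α_j − α_k))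
  = (∏_l c_l^{c_l−1})·α_i^{n−2m+1} / ∏_{j≠i}(α_i − α_j) · ∑_{j≠i} 1/(α_i − α_j)
    − (n − 2m + 1)·(∏_l c_l^{c_l−1})·α_i^{n−2m} / (2·∏_{j≠i}(α_i − α_j))`.
The exponents `n − 2m + 1` and `n − 2m` are taken as integers (`zpow`), so that
`α_i^{n−2m}` means `1/α_i` when `n − 2m = −1`. -/
theorem stmt_4 (m : ℕ) (hm : 2 ≤ m) (c : Fin m → ℕ) (hc : ∀ l, 0 < c l)
    (n N : ℕ) (hn : n = m - 1 + ∑ l, c l) (hN : N = n - m + 1)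
    (α : Fin N → ℂ) (hα : Function.Injective α) (hα0 : ∀ j, α j ≠ 0) (i : Fin N) :
    ∑ j ∈ univ.erase i,
        (∏ l, ∏ a ∈ Icc 1 (c l - 1), (((c l : ℂ) - (a : ℂ)) * α j + (a : ℂ) * α i)) /
          ((α j - α i) ^ 2 * ∏ k ∈ (univ.erase i).erase j, (α j - α k)) =
      (∏ l, (c l : ℂ) ^ (c l - 1)) * α i ^ ((n : ℤ) - 2 * m + 1) /
          (∏ j ∈ univ.erase i, (α i - α j)) *
          (∑ j ∈ univ.erase i, 1 / (α i - α j))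
        - ((n : ℂ) - 2 * m + 1) * (∏ l, (c l : ℂ) ^ (c l - 1)) * α i ^ ((n : ℤ) - 2 * m) /
            (2 * ∏ j ∈ univ.erase i, (α i - α j)) := by
  classical
  have hsum : m ≤ ∑ l, c l := by
    calc m = ∑ l : Fin m, 1 := by simp
      _ ≤ _ := Finset.sum_le_sum fun l _ => hc l
  have hNs : N = ∑ l, c l := by omega
  have hD : ∑ l, (c l - 1) + m = ∑ l, c l := by
    calc ∑ l, (c l - 1) + m = ∑ l, (c l - 1) + ∑ l : Fin m, 1 := by simp
      _ = ∑ l, (c l - 1 + 1) := by rw [Finset.sum_add_distrib]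
      _ = _ := Finset.sum_congr rfl fun l _ => Nat.sub_add_cancel (hc l)
  have hx0 := hα0 i
  set x := α i with hxdef
  let F : Fin m → ℕ → Polynomial ℂ := fun l a =>
    Polynomial.C ((c l : ℂ) - a) * Polynomial.X + Polynomial.C ((a : ℂ) * x)
  let P : Polynomial ℂ := ∏ l, ∏ a ∈ Icc 1 (c l - 1), F l a
  have hPe : ∀ y, P.eval y = ∏ l, ∏ a ∈ Icc 1 (c l - 1), (((c l : ℂ) - a) * y + a * x) := by
    intro y
    simp [P, F, Polynomial.eval_prod]
  have hFx : ∀ l a, (F l a).eval x = (c l : ℂ) * x := by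
    intro l a
    simp [F]; ring
  have hFx0 : ∀ l a, (F l a).eval x ≠ 0 := by
    intro l a
    rw [hFx]
    exact mul_ne_zero (by exact_mod_cast (hc l).ne') hx0
  have hFd : ∀ l a, (Polynomial.derivative (F l a)).eval x = (c l : ℂ) - a := by
    intro l a
    simp [F]
  have hPx : P.eval x = (∏ l, (c l : ℂ) ^ (c l - 1)) * x ^ (∑ l, (c l - 1)) := by
    simp only [P, Polynomial.eval_prod, hFx, Finset.prod_const, Nat.card_Icc,
      Nat.add_sub_cancel, mul_pow, Finset.prod_mul_distrib, Finset.prod_pow_eq_pow_sum]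
  have hPd : (Polynomial.derivative P).eval x =
      P.eval x * (((∑ l, (c l - 1) : ℕ) : ℂ) / (2 * x)) := by
    have hl : ∀ l, (∏ a ∈ Icc 1 (c l - 1), F l a).eval x ≠ 0 := by
      intro l
      rw [Polynomial.eval_prod]
      exact Finset.prod_ne_zero_iff.mpr fun a _ => hFx0 l a
    simp only [P]
    rw [aux_logder _ _ _ (fun l _ => hl l), Polynomial.eval_prod]
    congr 1
    rw [Nat.cast_sum, Finset.sum_div]
    refine Finset.sum_congr rfl fun l _ => ?_
    have h2 := hl l
    rw [aux_logder _ _ _ (fun a _ => hFx0 l a), ← Polynomial.eval_prod, mul_div_cancel_left₀ _ h2]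
    simp only [hFx, hFd]
    rw [aux_sum _ (hc l) _ hx0, Nat.cast_sub (hc l)]
    simp
  have hdeg : P.degree < ((univ.erase i).card : WithBot ℕ) := by
    rw [Finset.card_erase_of_mem (Finset.mem_univ i), Finset.card_univ, Fintype.card_fin]
    have h1 : P.natDegree ≤ ∑ l, (c l - 1) := by
      refine (Polynomial.natDegree_prod_le _ _).trans (Finset.sum_le_sum fun l _ => ?_)
      refine (Polynomial.natDegree_prod_le _ _).trans ?_
      refine (Finset.sum_le_sum (g := fun _ => 1) fun a _ => ?_).trans (by simp)
      exact Polynomial.natDegree_linear_le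
    refine Polynomial.degree_le_natDegree.trans_lt ?_
    have : P.natDegree < N - 1 := by omega
    exact_mod_cast this
  have hne : ∀ j ∈ univ.erase i, x - α j ≠ 0 := by
    intro j hj
    exact sub_ne_zero.mpr fun h => (Finset.ne_of_mem_erase hj) (hα h).symm
  have key := aux_residue (univ.erase i) α hα P hdeg x hne
  have hQ : (∏ j ∈ univ.erase i, (x - α j)) ≠ 0 := Finset.prod_ne_zero_iff.mpr hne
  simp only [← hPe]
  rw [key, hPd, hPx]
  have e1 : (n : ℤ) - 2 * m + 1 = ((∑ l, (c l - 1) : ℕ) : ℤ) := by omega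
  have e2 : (n : ℤ) - 2 * m = ((∑ l, (c l - 1) : ℕ) : ℤ) - 1 := by omega
  have e3 : (n : ℂ) - 2 * m + 1 = ((∑ l, (c l - 1) : ℕ) : ℂ) := by exact_mod_cast e1
  rw [e1, e2, e3, zpow_sub_one₀ hx0, zpow_natCast]
  field_simp
end

section
/- Let m ≥ 1 be an integer and c_1, …, c_m positive integers; set n = m − 1 + ∑_{i=1}^m c_i and assume n is odd, n = 2r + 1. Define f(w) = (2w + 1)·∏_{i=1}^{m} ∏_{s=1}^{c_i−1} (c_i·w + s) / ((w + 1)^{r−m+1}·w^{r−m+1}) for complex w ∉ {0, −1}. Then f(−1 − w) = −f(w) for all complex w with w ≠ 0 and w ≠ −1. -/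
open Finset

/-- Let `m ≥ 1`, `c_1, …, c_m` positive integers, `n = m − 1 + ∑ c_i`,
`n = 2r + 1` odd.  For
`f(w) = (2w + 1)·∏_i ∏_{s=1}^{c_i−1} (c_i·w + s) / ((w + 1)^{r−m+1}·w^{r−m+1})`
one has `f(−1 − w) = −f(w)` for all `w ∈ ℂ` with `w ≠ 0`, `w ≠ −1`.
(The natural-number exponent `r − m + 1` is written `r + 1 - m`, which agrees with it
since `r ≥ m − 1`.) -/
theorem stmt_9 (m : ℕ) (hm : 1 ≤ m) (c : Fin m → ℕ) (hc : ∀ i, 0 < c i)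
    (n r : ℕ) (hn : n = m - 1 + ∑ i, c i) (hodd : n = 2 * r + 1)
    (f : ℂ → ℂ)
    (hf : ∀ w : ℂ, f w =
      (2 * w + 1) * (∏ i, ∏ s ∈ Icc 1 (c i - 1), ((c i : ℂ) * w + (s : ℂ))) /
        ((w + 1) ^ (r + 1 - m) * w ^ (r + 1 - m)))
    (w : ℂ) (hw0 : w ≠ 0) (hw1 : w ≠ -1) :
    f (-1 - w) = -f w := by
  have key : ∀ i, ∏ s ∈ Icc 1 (c i - 1), ((c i : ℂ) * (-1 - w) + (s : ℂ)) =
      (-1) ^ (c i - 1) * ∏ s ∈ Icc 1 (c i - 1), ((c i : ℂ) * w + (s : ℂ)) := by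
    intro i
    have h1 : ∏ s ∈ Icc 1 (c i - 1), ((c i : ℂ) * (-1 - w) + (s : ℂ)) =
        ∏ s ∈ Icc 1 (c i - 1), ((-1) * ((c i : ℂ) * w + (s : ℂ))) := by
      refine Finset.prod_bij' (fun s _ => c i - s) (fun s _ => c i - s) ?_ ?_ ?_ ?_ ?_
      · intro s hs
        simp only [Finset.mem_Icc] at hs ⊢
        omega
      · intro s hs
        simp only [Finset.mem_Icc] at hs ⊢
        omega
      · intro s hs
        simp only [Finset.mem_Icc] at hs ⊢
        omega
      · intro s hs
        simp only [Finset.mem_Icc] at hs ⊢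
        omega
      · intro s hs
        simp only [Finset.mem_Icc] at hs
        have hle : s ≤ c i := by omega
        push_cast [Nat.cast_sub hle]
        ring
    rw [h1, Finset.prod_mul_distrib]
    simp
  have hsum : ∑ i, (c i - 1) + m = ∑ i, c i := by
    have h2 : ∑ i, (c i - 1 + 1) = ∑ i, c i :=
      Finset.sum_congr rfl (fun i _ => Nat.sub_add_cancel (hc i))
    rw [← h2, Finset.sum_add_distrib]
    simp
  have heven : Even (∑ i, (c i - 1)) := ⟨r + 1 - m, by omega⟩
  have hprod : ∏ i, ∏ s ∈ Icc 1 (c i - 1), ((c i : ℂ) * (-1 - w) + (s : ℂ)) =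
      ∏ i, ∏ s ∈ Icc 1 (c i - 1), ((c i : ℂ) * w + (s : ℂ)) := by
    rw [Finset.prod_congr rfl (fun i _ => key i), Finset.prod_mul_distrib,
      Finset.prod_pow_eq_pow_sum, heven.neg_one_pow, one_mul]
  have hden : (-1 - w + 1) ^ (r + 1 - m) * (-1 - w) ^ (r + 1 - m) =
      (w + 1) ^ (r + 1 - m) * w ^ (r + 1 - m) := by
    rw [← mul_pow, ← mul_pow]
    congr 1
    ring
  rw [hf, hf, hprod, hden, ← neg_div]
  congr 1
  ring
end

section
/- Let m ≥ 1 be an integer and c_1, …, c_m positive integers; set n = m − 1 + ∑_{i=1}^m c_i and assume n is even, n = 2r, with r ≥ m. Define g(w) = ∏_{i=1}^{m} ∏_{s=1}^{c_i−1} (c_i·w + s) / ((w + 1)^{r−m}·w^{r−m}) for complex w ∉ {0, −1}. Then g(−1 − w) = −g(w) for all complex w with w ≠ 0 and w ≠ −1. -/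
open Finset

theorem inner_refl (c : ℕ) (hc : 0 < c) (w : ℂ) :
    ∏ s ∈ Icc 1 (c - 1), ((c : ℂ) * (-1 - w) + (s : ℂ)) =
      (-1) ^ (c - 1) * ∏ s ∈ Icc 1 (c - 1), ((c : ℂ) * w + (s : ℂ)) := by
  have h1 : ∏ s ∈ Icc 1 (c - 1), ((c : ℂ) * w + (s : ℂ)) =
      ∏ s ∈ Icc 1 (c - 1), ((c : ℂ) * w + ((c : ℂ) - (s : ℂ))) := by
    refine Finset.prod_bij' (fun s _ => c - s) (fun s _ => c - s) ?_ ?_ ?_ ?_ ?_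
    · intro s hs; simp only [Finset.mem_Icc] at *; omega
    · intro s hs; simp only [Finset.mem_Icc] at *; omega
    · intro s hs; simp only [Finset.mem_Icc] at *; omega
    · intro s hs; simp only [Finset.mem_Icc] at *; omega
    · intro s hs
      simp only [Finset.mem_Icc] at hs
      rw [Nat.cast_sub (by omega)]; ring
  have h2 : ((-1 : ℂ)) ^ (c - 1) = ∏ _s ∈ Icc 1 (c - 1), (-1 : ℂ) := by simp
  rw [h1, h2, ← Finset.prod_mul_distrib]
  exact Finset.prod_congr rfl fun s _ => by ring

/-- Let `m ≥ 1`, `c_1, …, c_m` positive integers, `n = m − 1 + ∑ c_i`,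
`n = 2r` even with `r ≥ m`.  For
`g(w) = ∏_i ∏_{s=1}^{c_i−1} (c_i·w + s) / ((w + 1)^{r−m}·w^{r−m})`
one has `g(−1 − w) = −g(w)` for all `w ∈ ℂ` with `w ≠ 0`, `w ≠ −1`. -/
theorem stmt_10 (m : ℕ) (hm : 1 ≤ m) (c : Fin m → ℕ) (hc : ∀ i, 0 < c i)
    (n r : ℕ) (hn : n = m - 1 + ∑ i, c i) (heven : n = 2 * r) (hr : m ≤ r)
    (g : ℂ → ℂ)
    (hg : ∀ w : ℂ, g w =
      (∏ i, ∏ s ∈ Icc 1 (c i - 1), ((c i : ℂ) * w + (s : ℂ))) /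
        ((w + 1) ^ (r - m) * w ^ (r - m)))
    (w : ℂ) (hw0 : w ≠ 0) (hw1 : w ≠ -1) :
    g (-1 - w) = -g w := by
  have hsum : ∑ i, (c i - 1) + m = ∑ i, c i := by
    have : ∑ i, (c i - 1 + 1) = ∑ i, c i :=
      Finset.sum_congr rfl fun i _ => Nat.sub_add_cancel (hc i)
    rw [← this, Finset.sum_add_distrib]; simp
  have hodd : Odd (∑ i, (c i - 1)) := ⟨r - m, by omega⟩
  have hnum : (∏ i, ∏ s ∈ Icc 1 (c i - 1), ((c i : ℂ) * (-1 - w) + (s : ℂ))) =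
      -∏ i, ∏ s ∈ Icc 1 (c i - 1), ((c i : ℂ) * w + (s : ℂ)) := by
    rw [Finset.prod_congr rfl fun i _ => inner_refl (c i) (hc i) w, Finset.prod_mul_distrib,
      Finset.prod_pow_eq_pow_sum, hodd.neg_one_pow]
    ring
  have hden : (-1 - w + 1) ^ (r - m) * (-1 - w) ^ (r - m) =
      (w + 1) ^ (r - m) * w ^ (r - m) := by
    rw [← mul_pow, ← mul_pow]; congr 1; ring
  rw [hg, hg, hnum, hden, neg_div]
end

section
/- For every integer d ≥ 1, ( (2d)! / (d!)^2 ) · ( 2d·∑_{a=1}^{d} 1/(d + a) + 1 ) − ∑_{d_0=1}^{d−1} d_0·(2d_0)!·(2(d−d_0))! / ( (d_0!)^2·((d−d_0)!)^2·(d−d_0) ) = 4^d. -/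
open Finset

/-- central binomial coefficient as a rational -/
def cbq (n : ℕ) : ℚ := (Nat.centralBinom n : ℚ)

lemma cbq_zero : cbq 0 = 1 := by simp [cbq]

lemma cbq_succ (n : ℕ) : ((n : ℚ) + 1) * cbq (n + 1) = (4 * n + 2) * cbq n := by
  have h := Nat.succ_mul_centralBinom_succ n
  have h2 : (((n + 1) * (n + 1).centralBinom : ℕ) : ℚ)
      = ((2 * (2 * n + 1) * n.centralBinom : ℕ) : ℚ) := by rw [h]
  push_cast at h2
  unfold cbq
  linarith

lemma cbq_fact (n : ℕ) : ((2 * n).factorial : ℚ) / (n.factorial : ℚ) ^ 2 = cbq n := by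
  have h := Nat.choose_mul_factorial_mul_factorial (show n ≤ 2 * n by omega)
  rw [show 2 * n - n = n by omega, ← Nat.centralBinom_eq_two_mul_choose] at h
  have hn : (n.factorial : ℚ) ≠ 0 := by exact_mod_cast n.factorial_ne_zero
  rw [← h, cbq]
  push_cast
  field_simp

lemma conv_step (f : ℕ → ℚ) (n : ℕ) :
    ∑ p ∈ antidiagonal (n + 1), f p.1 * ((p.2 : ℚ) * cbq p.2)
      = ∑ p ∈ antidiagonal n, f p.1 * ((4 * (p.2 : ℚ) + 2) * cbq p.2) := by
  rw [Finset.Nat.sum_antidiagonal_succ']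
  simp only [Nat.cast_zero, zero_mul, mul_zero, add_zero, zero_add]
  refine Finset.sum_congr rfl fun p _ => ?_
  rw [← cbq_succ]
  push_cast
  rfl

lemma conv_sym (n : ℕ) :
    2 * ∑ p ∈ antidiagonal n, cbq p.1 * ((p.2 : ℚ) * cbq p.2)
      = n * ∑ p ∈ antidiagonal n, cbq p.1 * cbq p.2 := by
  have h : ∑ p ∈ antidiagonal n, cbq p.1 * ((p.2 : ℚ) * cbq p.2)
      = ∑ p ∈ antidiagonal n, cbq p.2 * ((p.1 : ℚ) * cbq p.1) :=
    (Finset.Nat.sum_antidiagonal_swap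
      (f := fun p : ℕ × ℕ => cbq p.1 * ((p.2 : ℚ) * cbq p.2))).symm
  rw [two_mul]
  nth_rewrite 2 [h]
  rw [← Finset.sum_add_distrib, Finset.mul_sum]
  refine Finset.sum_congr rfl fun p hp => ?_
  rw [← mem_antidiagonal.1 hp]
  push_cast
  ring

lemma conv_four (n : ℕ) : ∑ p ∈ antidiagonal n, cbq p.1 * cbq p.2 = 4 ^ n := by
  induction n with
  | zero => simp [cbq_zero]
  | succ n ih =>
    have h1 := conv_sym (n + 1)
    have h2 := conv_sym n
    rw [conv_step] at h1
    have h3 : ∑ p ∈ antidiagonal n, cbq p.1 * ((4 * (p.2 : ℚ) + 2) * cbq p.2)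
        = 4 * ∑ p ∈ antidiagonal n, cbq p.1 * ((p.2 : ℚ) * cbq p.2)
          + 2 * ∑ p ∈ antidiagonal n, cbq p.1 * cbq p.2 := by
      rw [Finset.mul_sum, Finset.mul_sum, ← Finset.sum_add_distrib]
      exact Finset.sum_congr rfl fun p _ => by ring
    rw [ih] at h2 h3
    have hn : ((n : ℚ) + 1) ≠ 0 := by positivity
    apply mul_left_cancel₀ hn
    push_cast at h1
    rw [← h1, h3, pow_succ]
    linarith

/-- the sum `∑ c_i c_j / i` -/
def tq (n : ℕ) : ℚ := ∑ p ∈ antidiagonal n, cbq p.1 / (p.1 : ℚ) * cbq p.2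

lemma conv_left (n : ℕ) :
    ∑ p ∈ antidiagonal n, (p.1 : ℚ) * (cbq p.1 / (p.1 : ℚ)) * cbq p.2 = 4 ^ n - cbq n := by
  rw [← conv_four]
  cases n with
  | zero => simp [cbq_zero]
  | succ n =>
    rw [Finset.Nat.sum_antidiagonal_succ, Finset.Nat.sum_antidiagonal_succ]
    simp only [Nat.cast_zero, zero_mul, cbq_zero, one_mul, zero_add, add_sub_cancel_left]
    refine Finset.sum_congr rfl fun p _ => ?_
    have : ((p.1 + 1 : ℕ) : ℚ) ≠ 0 := by positivity
    rw [mul_div_cancel₀ _ this]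

lemma tq_succ (n : ℕ) :
    ((n : ℚ) + 1) * tq (n + 1) = (4 * n + 2) * tq n + 4 * cbq n - cbq (n + 1) := by
  have h1 : ((n : ℚ) + 1) * tq (n + 1)
      = ∑ p ∈ antidiagonal (n + 1), (p.1 : ℚ) * (cbq p.1 / (p.1 : ℚ)) * cbq p.2
        + ∑ p ∈ antidiagonal (n + 1), cbq p.1 / (p.1 : ℚ) * ((p.2 : ℚ) * cbq p.2) := by
    rw [tq, Finset.mul_sum, ← Finset.sum_add_distrib]
    refine Finset.sum_congr rfl fun p hp => ?_
    have : ((n : ℚ) + 1) = p.1 + p.2 := by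
      exact_mod_cast (mem_antidiagonal.1 hp).symm
    rw [this]
    ring
  have h2 : ∑ p ∈ antidiagonal n, cbq p.1 / (p.1 : ℚ) * ((4 * (p.2 : ℚ) + 2) * cbq p.2)
      = (4 * n + 2) * tq n
        - 4 * ∑ p ∈ antidiagonal n, (p.1 : ℚ) * (cbq p.1 / (p.1 : ℚ)) * cbq p.2 := by
    rw [tq, Finset.mul_sum, Finset.mul_sum, ← Finset.sum_sub_distrib]
    refine Finset.sum_congr rfl fun p hp => ?_
    have : (n : ℚ) = p.1 + p.2 := by
      exact_mod_cast (mem_antidiagonal.1 hp).symm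
    rw [this]
    ring
  rw [h1, conv_step (fun i => cbq i / (i : ℚ)), h2, conv_left, conv_left]
  ring

/-- `∑ 1/(d+a)` -/
def hq (d : ℕ) : ℚ := ∑ a ∈ Icc 1 d, 1 / ((d : ℚ) + (a : ℚ))

lemma hq_range (d : ℕ) : hq d = ∑ a ∈ range d, 1 / ((d : ℚ) + a + 1) := by
  rw [hq, Finset.range_eq_Ico, ← Finset.Ico_add_one_right_eq_Icc,
    ← Finset.sum_Ico_add' (fun a : ℕ => 1 / ((d : ℚ) + (a : ℚ))) 0 d 1]
  refine Finset.sum_congr rfl fun a _ => ?_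
  push_cast
  rw [add_assoc]

lemma hq_succ (d : ℕ) : hq (d + 1) = hq d + 1 / (2 * d + 1) - 1 / (2 * d + 2) := by
  have h1 := Finset.sum_range_succ (fun a : ℕ => 1 / ((d : ℚ) + a + 1)) d
  have h2 := Finset.sum_range_succ' (fun a : ℕ => 1 / ((d : ℚ) + a + 1)) d
  rw [hq_range, hq_range, Finset.sum_range_succ]
  have h3 : ∑ a ∈ range d, 1 / (((d + 1 : ℕ) : ℚ) + a + 1)
      = ∑ a ∈ range d, 1 / ((d : ℚ) + ((a + 1 : ℕ) : ℚ) + 1) := by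
    refine Finset.sum_congr rfl fun a _ => ?_
    push_cast
    congr 1
    ring
  rw [h3]
  have h4 : (1 : ℚ) / (((d + 1 : ℕ) : ℚ) + d + 1) = 1 / (2 * d + 2) := by
    push_cast
    congr 1
    ring
  have h5 : (1 : ℚ) / (d + d + 1) = 1 / (2 * d + 1) := by
    congr 1
    ring
  have h6 : (1 : ℚ) / (d + (0 : ℕ) + 1) = 2 * (1 / (2 * d + 2)) := by
    push_cast
    have : (d : ℚ) + 1 ≠ 0 := by positivity
    field_simp
    ring
  rw [h4]
  rw [h6] at h2
  rw [h5] at h1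
  linarith

lemma tq_eq (d : ℕ) : tq d = 2 * hq d * cbq d := by
  induction d with
  | zero => simp [tq, hq]
  | succ n ih =>
    have hn : ((n : ℚ) + 1) ≠ 0 := by positivity
    have hn2 : (2 * (n : ℚ) + 1) ≠ 0 := by positivity
    have hc : cbq n = ((n : ℚ) + 1) * cbq (n + 1) / (4 * n + 2) := by
      rw [cbq_succ]
      have : (4 * (n : ℚ) + 2) ≠ 0 := by positivity
      field_simp
    apply mul_left_cancel₀ hn
    rw [tq_succ, ih, hq_succ, hc]
    rw [show (4 * (n : ℚ) + 2) = 2 * (2 * n + 1) by ring,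
      show (2 * (n : ℚ) + 2) = 2 * (n + 1) by ring]
    field_simp
    ring

/-- For every integer `d ≥ 1`,
`((2d)!/(d!)^2)·(2d·∑_{a=1}^{d} 1/(d+a) + 1)
  − ∑_{d_0=1}^{d−1} d_0·(2d_0)!·(2(d−d_0))! / ((d_0!)^2·((d−d_0)!)^2·(d−d_0)) = 4^d`. -/
theorem stmt_15 (d : ℕ) (hd : 1 ≤ d) :
    ((2 * d).factorial : ℚ) / ((d.factorial : ℚ)) ^ 2 *
        (2 * (d : ℚ) * (∑ a ∈ Icc 1 d, 1 / ((d : ℚ) + (a : ℚ))) + 1) -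
      ∑ d₀ ∈ Icc 1 (d - 1),
        (d₀ : ℚ) * ((2 * d₀).factorial : ℚ) * ((2 * (d - d₀)).factorial : ℚ) /
          (((d₀.factorial : ℚ)) ^ 2 * (((d - d₀).factorial : ℚ)) ^ 2 * ((d : ℚ) - (d₀ : ℚ))) =
      4 ^ d := by
  have hd0 : (d : ℚ) ≠ 0 := by
    have : d ≠ 0 := by omega
    exact_mod_cast this
  -- the sum over the whole antidiagonal, second index in the numerator
  have key : ∑ p ∈ antidiagonal d, (p.2 : ℚ) * (cbq p.1 / (p.1 : ℚ) * cbq p.2)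
      = d * tq d - (4 ^ d - cbq d) := by
    rw [← conv_left, tq, Finset.mul_sum, ← Finset.sum_sub_distrib]
    refine Finset.sum_congr rfl fun p hp => ?_
    have : (d : ℚ) = p.1 + p.2 := by
      exact_mod_cast (mem_antidiagonal.1 hp).symm
    rw [this]
    ring
  have hs : ∑ d₀ ∈ Icc 1 (d - 1),
        (d₀ : ℚ) * ((2 * d₀).factorial : ℚ) * ((2 * (d - d₀)).factorial : ℚ) /
          (((d₀.factorial : ℚ)) ^ 2 * (((d - d₀).factorial : ℚ)) ^ 2 * ((d : ℚ) - (d₀ : ℚ)))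
      = ∑ p ∈ antidiagonal d, (p.2 : ℚ) * (cbq p.1 / (p.1 : ℚ) * cbq p.2) := by
    rw [← Finset.Nat.sum_antidiagonal_swap, Finset.Nat.sum_antidiagonal_eq_sum_range_succ_mk]
    have hsub : Icc 1 (d - 1) ⊆ range d.succ := by
      intro x hx
      simp only [mem_Icc, mem_range] at hx ⊢
      omega
    rw [← Finset.sum_subset hsub]
    · refine Finset.sum_congr rfl fun x hx => ?_
      have hx' : x ≤ d := by
        simp only [mem_Icc] at hx
        omega
      simp only [Prod.swap, Prod.fst, Prod.snd]
      rw [← cbq_fact, ← cbq_fact, Nat.cast_sub hx']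
      simp only [div_eq_mul_inv, mul_inv]
      ring
    · intro x hx hx2
      simp only [mem_Icc, mem_range] at hx hx2
      have : x = 0 ∨ x = d := by omega
      rcases this with rfl | rfl <;> simp
  rw [hs, key, cbq_fact, tq_eq]
  change cbq d * (2 * (d : ℚ) * hq d + 1) - _ = _
  ring
end

section
/- Let N ≥ 2 be an integer and let α_1, …, α_N be pairwise distinct complex numbers. Then ∑_{i=1}^{N} ∑_{j≠i} ∏_{k≠i,j} ( (α_i − α_k) / (α_j − α_k) ) = N. -/
open Finset

/-- Let `N ≥ 2` and `α_1, …, α_N` pairwise distinct complex numbers.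
Then `∑_{i=1}^{N} ∑_{j≠i} ∏_{k≠i,j} ((α_i − α_k) / (α_j − α_k)) = N`. -/
theorem stmt_17 (N : ℕ) (hN : 2 ≤ N) (α : Fin N → ℂ) (hα : Function.Injective α) :
    ∑ i : Fin N, ∑ j ∈ univ.erase i,
        ∏ k ∈ (univ.erase i).erase j, ((α i - α k) / (α j - α k)) = (N : ℂ) := by
  have key : ∀ i : Fin N, ∑ j ∈ univ.erase i,
        ∏ k ∈ (univ.erase i).erase j, ((α i - α k) / (α j - α k)) = 1 := by
    intro i
    have hne : (univ.erase i : Finset (Fin N)).Nonempty := by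
      rw [← Finset.card_pos, Finset.card_erase_of_mem (mem_univ i), Finset.card_univ,
        Fintype.card_fin]
      omega
    have h := congrArg (Polynomial.eval (α i))
      (Lagrange.sum_basis (s := univ.erase i) (v := α) hα.injOn hne)
    rw [Polynomial.eval_finsetSum, Polynomial.eval_one] at h
    rw [← h]
    refine Finset.sum_congr rfl fun j _ => ?_
    rw [Lagrange.basis, Polynomial.eval_prod]
    refine Finset.prod_congr rfl fun k _ => ?_
    simp [Lagrange.basisDivisor, div_eq_inv_mul]
  rw [Finset.sum_congr rfl fun i _ => key i]
  simp
end
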